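/- (De Caen corollary for pairwise independent events.) Let {A_i}_{i∈I} be a finite family of events in a probability space such that Pr(A_i ∩ A_j) = Pr(A_i)·Pr(A_j) for all i ≠ j, and Pr(A_i) > 0 for each i. Then Pr(∪_{i∈I} A_i) ≥ Σ_{i∈I} Pr(A_i) / (1 + Σ_{j∈I, j≠i} Pr(A_j)). -/

import Mathlib

open MeasureTheory

/-- The pointwise inequality behind de Caen's bound: each point of the union satisfies
`2 c - c² N ≤ 1 / N`, where `N` is the number of sets containing it. -/
theorem sum_indicator_tangent_le_indicator_iUnion {α I : Type*} [Fintype I]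
    (A : I → Set α) (c : I → ℝ) (x : α) :
    ∑ i, (2 * c i * (A i).indicator 1 x - c i ^ 2 * ∑ j, (A i ∩ A j).indicator 1 x) ≤
      (⋃ i, A i).indicator (1 : α → ℝ) x := by
  classical
  by_cases hx : x ∈ ⋃ i, A i
  · obtain ⟨k, hk⟩ := Set.mem_iUnion.mp hx
    set N : ℝ := ∑ j, (A j).indicator (1 : α → ℝ) x with hN
    have hnonneg : ∀ j, 0 ≤ (A j).indicator (1 : α → ℝ) x := fun j =>
      Set.indicator_nonneg (fun _ _ => zero_le_one) x
    have hNpos : 0 < N :=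
      Finset.sum_pos' (fun j _ => hnonneg j) ⟨k, Finset.mem_univ k, by simp [hk]⟩
    have htangent : ∀ i, 2 * c i - c i ^ 2 * N ≤ 1 / N := fun i => by
      rw [le_div_iff₀ hNpos]
      nlinarith [sq_nonneg (c i * N - 1)]
    calc _ = ∑ i, (A i).indicator (1 : α → ℝ) x * (2 * c i - c i ^ 2 * N) := by
          refine Finset.sum_congr rfl fun i _ => ?_
          simp only [Set.inter_indicator_one, Pi.mul_apply, ← Finset.mul_sum, ← hN]
          ring
      _ ≤ ∑ i, (A i).indicator (1 : α → ℝ) x * (1 / N) :=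
          Finset.sum_le_sum fun i _ => mul_le_mul_of_nonneg_left (htangent i) (hnonneg i)
      _ = 1 := by rw [← Finset.sum_mul, ← hN, mul_one_div_cancel hNpos.ne']
      _ = _ := by simp only [Set.indicator_of_mem hx, Pi.one_apply]
  · have hx' : ∀ i, x ∉ A i := by simpa using hx
    simp [hx']

/-- De Caen's lower bound for the measure of a finite union. -/
theorem sum_sq_div_sum_measureReal_inter_le_measureReal_iUnion {α I : Type*} [MeasurableSpace α]
    (μ : Measure α) [IsFiniteMeasure μ] [Fintype I] (A : I → Set α)
    (hA : ∀ i, MeasurableSet (A i)) :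
    ∑ i, μ.real (A i) ^ 2 / ∑ j, μ.real (A i ∩ A j) ≤ μ.real (⋃ i, A i) := by
  set c : I → ℝ := fun i => μ.real (A i) / ∑ j, μ.real (A i ∩ A j) with hc
  have hint : ∀ s : Set α, MeasurableSet s → Integrable (s.indicator (1 : α → ℝ)) μ :=
    fun s hs => (integrable_const (1 : ℝ)).indicator hs
  have hinter : ∀ i j, Integrable ((A i ∩ A j).indicator (1 : α → ℝ)) μ :=
    fun i j => hint _ ((hA i).inter (hA j))
  have hsum : ∀ i, Integrable (fun x => ∑ j, (A i ∩ A j).indicator (1 : α → ℝ) x) μ :=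
    fun i => integrable_finsetSum _ fun j _ => hinter i j
  have hterm : ∀ i, Integrable (fun x => 2 * c i * (A i).indicator (1 : α → ℝ) x -
      c i ^ 2 * ∑ j, (A i ∩ A j).indicator (1 : α → ℝ) x) μ := fun i =>
    ((hint _ (hA i)).const_mul _).sub ((hsum i).const_mul _)
  have hmono := integral_mono (integrable_finsetSum Finset.univ fun i _ => hterm i)
    (hint _ (MeasurableSet.iUnion hA)) (sum_indicator_tangent_le_indicator_iUnion A c)
  rw [integral_indicator_one (MeasurableSet.iUnion hA),
    integral_finsetSum _ fun i _ => hterm i] at hmono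
  refine le_of_eq_of_le (Finset.sum_congr rfl fun i _ => ?_) hmono
  rw [integral_sub ((hint _ (hA i)).const_mul _) ((hsum i).const_mul _), integral_const_mul,
    integral_const_mul, integral_finsetSum _ fun j _ => hinter i j,
    integral_indicator_one (hA i)]
  simp only [integral_indicator_one ((hA i).inter (hA _)), hc]
  by_cases hd : ∑ j, μ.real (A i ∩ A j) = 0
  · simp [hd]
  · field_simp
    ring

/-- de Caen corollary for pairwise independent events. For a
finite family of pairwise independent events `{A_i}_{i∈I}`, each of positive
probability, `Pr(∪_i A_i) ≥ Σ_i Pr(A_i) / (1 + Σ_{j≠i} Pr(A_j))`. -/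
theorem stmt_18
    {α I : Type*} [MeasurableSpace α] (μ : Measure α) [IsProbabilityMeasure μ]
    [Fintype I] [DecidableEq I]
    (A : I → Set α) (hAmeas : ∀ i, MeasurableSet (A i))
    (hApos : ∀ i, 0 < (μ (A i)).toReal)
    (hPairInd : ∀ i j, i ≠ j →
      (μ (A i ∩ A j)).toReal = (μ (A i)).toReal * (μ (A j)).toReal) :
    ∑ i, (μ (A i)).toReal /
        (1 + ∑ j ∈ Finset.univ.erase i, (μ (A j)).toReal) ≤
      (μ (⋃ i, A i)).toReal := by
  refine le_of_eq_of_le (Finset.sum_congr rfl fun i _ => ?_)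
    (sum_sq_div_sum_measureReal_inter_le_measureReal_iUnion μ A hAmeas)
  have hden : ∑ j, μ.real (A i ∩ A j) =
      (μ (A i)).toReal * (1 + ∑ j ∈ Finset.univ.erase i, (μ (A j)).toReal) := by
    rw [← Finset.add_sum_erase _ _ (Finset.mem_univ i), Set.inter_self, mul_add, mul_one,
      Finset.mul_sum]
    exact congrArg _ (Finset.sum_congr rfl fun j hj =>
      hPairInd i j (Finset.ne_of_mem_erase hj).symm)
  rw [hden, sq]
  exact (mul_div_mul_left _ _ (hApos i).ne').symm
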